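/- arXiv:2404.02325 — 3 statements merged into one kernel-verified Lean document; each statement's English description precedes it below -/
import Mathlib

section
/- Let 0 < T < 1, let θ ∈ Δⁿ, and let I ⊆ {1,…,n} be an index set such that min_{i∈I} θᵢ > 0 and max_{i∈I} θᵢ > min_{i∈I} θᵢ. Then V_I(τ_T(θ)) > V_I(θ); i.e., for 0 < T < 1 the softmax-temperature map τ_T is expanding. -/
open scoped BigOperators

/-- The probability simplex `Δⁿ = {x ∈ ℝⁿ : xᵢ ≥ 0, ∑ᵢ xᵢ = 1}`. -/
def simplex (n : ℕ) : Set (Fin n → ℝ) := {x | (∀ i, 0 ≤ x i) ∧ ∑ i, x i = 1}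

/-- The softmax-temperature map `τ_T(θ)ᵢ = θᵢ^{1/T} / ∑ⱼ θⱼ^{1/T}`
(with the convention `0^{1/T} = 0`, which holds for `Real.rpow` since `1/T ≠ 0`). -/
noncomputable def tauT {n : ℕ} (T : ℝ) (θ : Fin n → ℝ) : Fin n → ℝ :=
  fun i => θ i ^ (1 / T) / ∑ j, θ j ^ (1 / T)

/-- The Lyapunov function
`V_I(θ) = max_{i∈I} θᵢ/∑_{j∈I} θⱼ − min_{i∈I} θᵢ/∑_{j∈I} θⱼ` for a nonempty index set `I`. -/
noncomputable def VI {n : ℕ} (I : Finset (Fin n)) (hI : I.Nonempty) (θ : Fin n → ℝ) : ℝ :=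
  (I.sup' hI fun i => θ i / ∑ j ∈ I, θ j) - (I.inf' hI fun i => θ i / ∑ j ∈ I, θ j)

theorem rpow_mul_lt_rpow_mul {x y p : ℝ} (hx : 0 < x) (hxy : x < y) (hp : 1 < p) :
    x ^ p * y < y ^ p * x := by
  have hy : 0 < y := hx.trans hxy
  have h : x ^ (p - 1) < y ^ (p - 1) := Real.rpow_lt_rpow hx.le hxy (sub_pos.2 hp)
  have hsplit : ∀ z : ℝ, 0 < z → z ^ p = z ^ (p - 1) * z := fun z hz => by
    rw [Real.rpow_sub_one hz.ne', div_mul_cancel₀ _ hz.ne']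
  rw [hsplit x hx, hsplit y hy, mul_assoc, mul_assoc, mul_comm y x]
  exact mul_lt_mul_of_pos_right h (mul_pos hx hy)

theorem rpow_mul_le_rpow_mul {x y p : ℝ} (hx : 0 < x) (hxy : x ≤ y) (hp : 1 < p) :
    x ^ p * y ≤ y ^ p * x := by
  rcases hxy.eq_or_lt with rfl | hlt
  · exact le_rfl
  · exact (rpow_mul_lt_rpow_mul hx hlt hp).le

/-- Raising to a power `p > 1` strictly increases the relative share of the largest entry. -/
theorem div_sum_lt_rpow_div_sum_rpow {ι : Type*} {s : Finset ι} {f : ι → ℝ} {p : ℝ} {a b : ι}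
    (hp : 1 < p) (hf : ∀ i ∈ s, 0 < f i) (ha : a ∈ s) (hb : b ∈ s)
    (hmax : ∀ i ∈ s, f i ≤ f a) (hba : f b < f a) :
    f a / ∑ j ∈ s, f j < f a ^ p / ∑ j ∈ s, f j ^ p := by
  rw [div_lt_div_iff₀ (Finset.sum_pos hf ⟨a, ha⟩)
    (Finset.sum_pos (fun i hi => Real.rpow_pos_of_pos (hf i hi) p) ⟨a, ha⟩),
    mul_comm (f a), Finset.sum_mul, Finset.mul_sum]
  exact Finset.sum_lt_sum (fun i hi => rpow_mul_le_rpow_mul (hf i hi) (hmax i hi) hp)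
    ⟨b, hb, rpow_mul_lt_rpow_mul (hf b hb) hba hp⟩

/-- Raising to a power `p > 1` strictly decreases the relative share of the smallest entry. -/
theorem rpow_div_sum_rpow_lt_div_sum {ι : Type*} {s : Finset ι} {f : ι → ℝ} {p : ℝ} {a b : ι}
    (hp : 1 < p) (hf : ∀ i ∈ s, 0 < f i) (ha : a ∈ s) (hb : b ∈ s)
    (hmin : ∀ i ∈ s, f b ≤ f i) (hba : f b < f a) :
    f b ^ p / ∑ j ∈ s, f j ^ p < f b / ∑ j ∈ s, f j := by
  rw [div_lt_div_iff₀
    (Finset.sum_pos (fun i hi => Real.rpow_pos_of_pos (hf i hi) p) ⟨a, ha⟩)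
    (Finset.sum_pos hf ⟨a, ha⟩), mul_comm (f b), Finset.sum_mul, Finset.mul_sum]
  exact Finset.sum_lt_sum (fun i hi => rpow_mul_le_rpow_mul (hf b hb) (hmin i hi) hp)
    ⟨a, ha, rpow_mul_lt_rpow_mul (hf b hb) hba hp⟩

/-- The normalizing constant of `tauT` cancels in relative shares. -/
theorem tauT_div_sum_tauT {n : ℕ} (T : ℝ) {θ : Fin n → ℝ} (hZ : ∑ j, θ j ^ (1 / T) ≠ 0)
    (I : Finset (Fin n)) (i : Fin n) :
    tauT T θ i / ∑ j ∈ I, tauT T θ j = θ i ^ (1 / T) / ∑ j ∈ I, θ j ^ (1 / T) := by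
  simp only [tauT]
  rw [← Finset.sum_div, div_div_div_cancel_right₀ hZ]

/-- Low temperature is expanding: for `0 < T < 1`, `θ ∈ Δⁿ` and an index set `I` with
`min_{i∈I} θᵢ > 0` and `max_{i∈I} θᵢ > min_{i∈I} θᵢ`, we have `V_I(τ_T(θ)) > V_I(θ)`. -/
theorem VI_tauT_gt_of_temp_lt_one {n : ℕ} (T : ℝ) (hT0 : 0 < T) (hT1 : T < 1)
    (θ : Fin n → ℝ) (hθ : θ ∈ simplex n)
    (I : Finset (Fin n)) (hI : I.Nonempty)
    (hmin : 0 < I.inf' hI θ) (hlt : I.inf' hI θ < I.sup' hI θ) :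
    VI I hI (tauT T θ) > VI I hI θ := by
  obtain ⟨a, ha, hsup⟩ := I.exists_mem_eq_sup' hI θ
  obtain ⟨b, hb, hinf⟩ := I.exists_mem_eq_inf' hI θ
  have hmax : ∀ i ∈ I, θ i ≤ θ a := fun i hi => hsup ▸ I.le_sup' θ hi
  have hmin' : ∀ i ∈ I, θ b ≤ θ i := fun i hi => hinf ▸ I.inf'_le θ hi
  have hpos : ∀ i ∈ I, 0 < θ i := fun i hi => (hinf ▸ hmin).trans_le (hmin' i hi)
  have hba : θ b < θ a := by rwa [hsup, hinf] at hlt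
  have hp : 1 < 1 / T := one_lt_one_div hT0 hT1
  have hS : 0 ≤ ∑ j ∈ I, θ j := Finset.sum_nonneg fun i hi => (hpos i hi).le
  have hZ : 0 < ∑ j, θ j ^ (1 / T) :=
    Finset.sum_pos' (fun i _ => Real.rpow_nonneg (hθ.1 i) _)
      ⟨a, Finset.mem_univ a, Real.rpow_pos_of_pos (hpos a ha) _⟩
  have hle : VI I hI θ ≤ θ a / ∑ j ∈ I, θ j - θ b / ∑ j ∈ I, θ j :=
    sub_le_sub
      (Finset.sup'_le hI _ fun i hi => div_le_div_of_nonneg_right (hmax i hi) hS)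
      (Finset.le_inf' hI _ fun i hi => div_le_div_of_nonneg_right (hmin' i hi) hS)
  have hge : tauT T θ a / ∑ j ∈ I, tauT T θ j - tauT T θ b / ∑ j ∈ I, tauT T θ j
      ≤ VI I hI (tauT T θ) :=
    sub_le_sub
      (Finset.le_sup' (fun i => tauT T θ i / ∑ j ∈ I, tauT T θ j) ha)
      (Finset.inf'_le (fun i => tauT T θ i / ∑ j ∈ I, tauT T θ j) hb)
  rw [tauT_div_sum_tauT T hZ.ne', tauT_div_sum_tauT T hZ.ne'] at hge
  exact (hle.trans_lt (sub_lt_sub (div_sum_lt_rpow_div_sum_rpow hp hpos ha hb hmax hba)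
    (rpow_div_sum_rpow_lt_div_sum hp hpos ha hb hmin' hba))).trans_le hge
end

section
/- Let τ : Δⁿ → Δⁿ be continuous, order preserving and expanding, let I ⊆ {1,…,n} be a nonempty index set, and for a > 0 define B(a) = Δⁿ \ (Ω̲_I(a) ∪ Ω̄_I(a)). If B(a) is nonempty, then inf over θ in the closure of B(a) of (V_I(τ(θ)) − V_I(θ)) is strictly positive. -/
open scoped BigOperators

/-- `Ω̲_I(a) = {θ ∈ Δⁿ : V_I(θ) ≤ a}`, a neighborhood of the conditional uniform vector. -/
noncomputable def OmegaLow {n : ℕ} (I : Finset (Fin n)) (hI : I.Nonempty) (a : ℝ) :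
    Set (Fin n → ℝ) :=
  {θ ∈ simplex n | VI I hI θ ≤ a}

/-- `Ω̄_I(a) = {θ ∈ Δⁿ : min_{i∈I} θᵢ ≤ a}`, a neighborhood of the simplex boundary. -/
noncomputable def OmegaHigh {n : ℕ} (I : Finset (Fin n)) (hI : I.Nonempty) (a : ℝ) :
    Set (Fin n → ℝ) :=
  {θ ∈ simplex n | I.inf' hI θ ≤ a}

/-- `V_I` is continuous wherever the conditioning mass `∑_{j∈I} θⱼ` does not vanish. -/
lemma continuousOn_VI {n : ℕ} (I : Finset (Fin n)) (hI : I.Nonempty) {s : Set (Fin n → ℝ)}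
    (hs : ∀ θ ∈ s, ∑ j ∈ I, θ j ≠ 0) : ContinuousOn (VI I hI) s := by
  have hquot : ∀ i ∈ I, ContinuousOn (fun θ : Fin n → ℝ => θ i / ∑ j ∈ I, θ j) s :=
    fun i _ => ContinuousOn.div (by fun_prop) (by fun_prop) hs
  exact (ContinuousOn.finset_sup'_apply hI hquot).sub (ContinuousOn.finset_inf'_apply hI hquot)

/-- If `V_I(θ) > 0` and the conditioning mass is positive, then `θ` is not constant on `I`. -/
lemma exists_lt_of_VI_pos {n : ℕ} {I : Finset (Fin n)} {hI : I.Nonempty} {θ : Fin n → ℝ}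
    (hsum : 0 < ∑ j ∈ I, θ j) (hV : 0 < VI I hI θ) : ∃ i ∈ I, ∃ j ∈ I, θ i < θ j := by
  obtain ⟨j, hj, hsup⟩ := I.exists_mem_eq_sup' hI fun i => θ i / ∑ j ∈ I, θ j
  obtain ⟨i, hi, hinf⟩ := I.exists_mem_eq_inf' hI fun i => θ i / ∑ j ∈ I, θ j
  refine ⟨i, hi, j, hj, ?_⟩
  rw [VI, hsup, hinf, sub_pos] at hV
  exact (div_lt_div_iff_of_pos_right hsum).1 hV

/-- A point of the simplex whose coordinates in `I` have positive minimum has positive mass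
on `I`. -/
lemma sum_pos_of_inf'_pos {n : ℕ} {I : Finset (Fin n)} {hI : I.Nonempty} {θ : Fin n → ℝ}
    (h : 0 < I.inf' hI θ) : 0 < ∑ j ∈ I, θ j :=
  Finset.sum_pos (fun _ hi => h.trans_le (Finset.inf'_le _ hi)) hI

/-- On the closure of `Δⁿ \ (Ω̲_I(a) ∪ Ω̄_I(a))` the defining inequalities hold weakly. -/
lemma closure_diff_Omega_subset {n : ℕ} (I : Finset (Fin n)) (hI : I.Nonempty) {a : ℝ}
    (ha : 0 < a) :
    closure (simplex n \ (OmegaLow I hI a ∪ OmegaHigh I hI a)) ⊆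
      {θ ∈ simplex n | a ≤ I.inf' hI θ ∧ a ≤ VI I hI θ} := by
  have hinf : Continuous fun θ : Fin n → ℝ => I.inf' hI θ :=
    Continuous.finset_inf'_apply hI fun i _ => continuous_apply i
  have hC : IsClosed (simplex n ∩ {θ | a ≤ I.inf' hI θ}) :=
    (isCompact_stdSimplex ℝ (Fin n)).isClosed.inter (isClosed_le continuous_const hinf)
  have hV : ContinuousOn (VI I hI) (simplex n ∩ {θ | a ≤ I.inf' hI θ}) :=
    continuousOn_VI I hI fun θ hθ => (sum_pos_of_inf'_pos (ha.trans_le hθ.2)).ne'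
  have hK := hV.preimage_isClosed_of_isClosed hC (isClosed_Ici (a := a))
  refine (closure_minimal ?_ hK).trans fun θ hθ => ⟨hθ.1.1, hθ.1.2, hθ.2⟩
  rintro θ ⟨hθ, hnot⟩
  exact ⟨⟨hθ, le_of_not_ge fun h => hnot (Or.inr ⟨hθ, h⟩)⟩,
    le_of_not_ge fun h => hnot (Or.inl ⟨hθ, h⟩)⟩

/-- If `τ : Δⁿ → Δⁿ` is continuous, order preserving and expanding, `I` is a nonempty index
set, `a > 0`, and `B(a) = Δⁿ \ (Ω̲_I(a) ∪ Ω̄_I(a))` is nonempty, then the infimum of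
`V_I(τ(θ)) − V_I(θ)` over the closure of `B(a)` is strictly positive. -/
theorem inf_VI_increase_pos {n : ℕ}
    (τ : (Fin n → ℝ) → (Fin n → ℝ))
    (hτmap : ∀ θ ∈ simplex n, τ θ ∈ simplex n)
    (hτcont : ContinuousOn τ (simplex n))
    (hτord : ∀ θ ∈ simplex n, ∀ i j : Fin n,
      (θ i < θ j → τ θ i < τ θ j) ∧ (θ i = θ j → τ θ i = τ θ j))
    (hτexp : ∀ θ ∈ simplex n, ∀ (J : Finset (Fin n)) (hJ : J.Nonempty),
      0 < J.inf' hJ θ → J.inf' hJ θ < J.sup' hJ θ → VI J hJ θ < VI J hJ (τ θ))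
    (I : Finset (Fin n)) (hI : I.Nonempty) (a : ℝ) (ha : 0 < a)
    (hne : (simplex n \ (OmegaLow I hI a ∪ OmegaHigh I hI a)).Nonempty) :
    0 < sInf ((fun θ => VI I hI (τ θ) - VI I hI θ) ''
        closure (simplex n \ (OmegaLow I hI a ∪ OmegaHigh I hI a))) := by
  set B := simplex n \ (OmegaLow I hI a ∪ OmegaHigh I hI a)
  have hsub := closure_diff_Omega_subset I hI ha
  have hcompact : IsCompact (closure B) :=
    (isCompact_stdSimplex ℝ (Fin n)).of_isClosed_subset isClosed_closure
      fun θ hθ => (hsub hθ).1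
  have hsum : ∀ θ ∈ closure B, 0 < ∑ j ∈ I, θ j := fun θ hθ =>
    sum_pos_of_inf'_pos (ha.trans_le (hsub hθ).2.1)
  have hlt : ∀ θ ∈ closure B, ∃ i ∈ I, ∃ j ∈ I, θ i < θ j := fun θ hθ =>
    exists_lt_of_VI_pos (hsum θ hθ) (ha.trans_le (hsub hθ).2.2)
  have hsumτ : ∀ θ ∈ closure B, 0 < ∑ j ∈ I, τ θ j := by
    intro θ hθ
    obtain ⟨i, -, j, hj, hij⟩ := hlt θ hθ
    have hnonneg := (hτmap θ (hsub hθ).1).1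
    exact Finset.sum_pos' (fun k _ => hnonneg k)
      ⟨j, hj, (hnonneg i).trans_lt ((hτord θ (hsub hθ).1 i j).1 hij)⟩
  have hcont : ContinuousOn (fun θ => VI I hI (τ θ) - VI I hI θ) (closure B) := by
    refine ContinuousOn.sub ?_ (continuousOn_VI I hI fun θ hθ => (hsum θ hθ).ne')
    refine (continuousOn_VI I hI (s := τ '' closure B) ?_).comp
      (hτcont.mono fun θ hθ => (hsub hθ).1) (Set.mapsTo_image τ _)
    rintro _ ⟨θ, hθ, rfl⟩
    exact (hsumτ θ hθ).ne'
  obtain ⟨θ, hθ, heq⟩ := hcompact.exists_sInf_image_eq hne.closure hcont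
  obtain ⟨i, hi, j, hj, hij⟩ := hlt θ hθ
  rw [heq, sub_pos]
  exact hτexp θ (hsub hθ).1 I hI (ha.trans_le (hsub hθ).2.1)
    ((Finset.inf'_le _ hi).trans_lt (hij.trans_le (Finset.le_sup' _ hj)))
end

section
/- Let τ : Δⁿ → Δⁿ be continuous, order preserving and expanding, and define the vector field F(θ) = τ(θ) − θ. Then for every nonempty index set I ⊆ {1,…,n} there exist η̄ > 0 and a class-K function κ : [0, η̄) → [0, ∞) such that: for every η ∈ [0, η̄), every t₀ ∈ ℝ, every measurable perturbation ε : [t₀, ∞) → ℝⁿ with ‖ε(t)‖ ≤ η for all t, and every locally absolutely continuous solution θ : [t₀, ∞) → Δⁿ of the differential equation θ'(t) = F(θ(t)) + ε(t), if θ(t₀) ∉ Ω̲_I(κ(η)) then dist(θ(t), Ω̄_I(κ(η))) → 0 as t → ∞. -/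
open scoped BigOperators
open Filter

/-- The probability simplex `Δⁿ ⊆ ℝⁿ` (with the Euclidean norm). -/
def simplexE (n : ℕ) : Set (EuclideanSpace ℝ (Fin n)) :=
  {x | (∀ i, 0 ≤ x i) ∧ ∑ i, x i = 1}

/-- The Lyapunov function
`V_I(θ) = max_{i∈I} θᵢ/∑_{j∈I} θⱼ − min_{i∈I} θᵢ/∑_{j∈I} θⱼ` for a nonempty index set `I`. -/
noncomputable def VIE {n : ℕ} (I : Finset (Fin n)) (hI : I.Nonempty)
    (θ : EuclideanSpace ℝ (Fin n)) : ℝ :=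
  (I.sup' hI fun i => θ i / ∑ j ∈ I, θ j) - (I.inf' hI fun i => θ i / ∑ j ∈ I, θ j)

/-- `Ω̲_I(a) = {θ ∈ Δⁿ : V_I(θ) ≤ a}`, a neighborhood of the conditional uniform vector. -/
noncomputable def OmegaLowE {n : ℕ} (I : Finset (Fin n)) (hI : I.Nonempty) (a : ℝ) :
    Set (EuclideanSpace ℝ (Fin n)) :=
  {θ ∈ simplexE n | VIE I hI θ ≤ a}

/-- `Ω̄_I(a) = {θ ∈ Δⁿ : min_{i∈I} θᵢ ≤ a}`, a neighborhood of the simplex boundary. -/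
noncomputable def OmegaHighE {n : ℕ} (I : Finset (Fin n)) (hI : I.Nonempty) (a : ℝ) :
    Set (EuclideanSpace ℝ (Fin n)) :=
  {θ ∈ simplexE n | I.inf' hI (fun i => θ i) ≤ a}

section ModeCollapse

open Set Topology

/-- A property `Q r m` of positive scales `r`, monotone in `r` and antitone in `m`, and valid for
some `m > 0` at every scale, holds along the graph of a class-K function. -/
theorem exists_classK_of_monotone {Q : ℝ → ℝ → Prop}
    (hmono : ∀ r r' m m', 0 < r → r ≤ r' → m' ≤ m → Q r m → Q r' m')
    (hex : ∀ r, 0 < r → ∃ m > 0, Q r m) :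
    ∃ ηbar > (0 : ℝ), ∃ κ : ℝ → ℝ, Continuous κ ∧ StrictMono κ ∧ κ 0 = 0 ∧
      ∀ η ∈ Ioo 0 ηbar, κ η < 1 ∧ Q (κ η) η := by
  set B : Set (ℝ × ℝ) := {p | ¬ (0 < p.1 ∧ Q p.1 p.2)} with hB
  set h : ℝ → ℝ := fun r => Metric.infDist (r, (0 : ℝ)) B with hh
  have hcont : Continuous h := by
    have := Metric.continuous_infDist_pt B
    exact this.comp (by fun_prop)
  have hnonneg : ∀ r, 0 ≤ h r := fun r => Metric.infDist_nonneg
  have hneg : ∀ r, r ≤ 0 → h r = 0 := by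
    intro r hr
    apply Metric.infDist_zero_of_mem
    simp only [hB, mem_ofPred_eq, not_and]
    intro h1; linarith
  have hBne : B.Nonempty := ⟨(0, 0), by simp [hB]⟩
  have hmonoh : Monotone h := by
    intro r r' hrr
    refine (Metric.le_infDist hBne).2 ?_
    rintro ⟨s, m⟩ hsm
    have hmem : (s - (r' - r), m) ∈ B := by
      simp only [hB, mem_ofPred_eq] at hsm ⊢
      rintro ⟨h1, h2⟩
      exact hsm ⟨by linarith, hmono _ _ _ _ h1 (by linarith) le_rfl h2⟩
    refine (Metric.infDist_le_dist_of_mem hmem).trans (le_of_eq ?_)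
    simp only [Prod.dist_eq, Real.dist_eq]
    congr 2
    ring
  have hpos : ∀ r, 0 < r → 0 < h r := by
    intro r hr
    obtain ⟨m, hm, hQ⟩ := hex (r / 2) (by linarith)
    refine lt_of_lt_of_le (lt_min (half_pos hr) hm) ((Metric.le_infDist hBne).2 ?_)
    rintro ⟨s, m'⟩ hsm
    simp only [Prod.dist_eq, Real.dist_eq]
    by_contra! hlt
    rw [max_lt_iff, lt_min_iff, lt_min_iff] at hlt
    obtain ⟨⟨h1, -⟩, -, h2⟩ := hlt
    rw [abs_lt] at h1 h2
    apply hsm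
    exact ⟨by dsimp only; linarith, hmono _ _ _ _ (half_pos hr) (by dsimp only; linarith)
      (by dsimp only; linarith) hQ⟩
  have hQ : ∀ r m, 0 < r → 0 ≤ m → m < h r → Q r m := by
    intro r m hr hm hlt
    by_contra hn
    have : (r, m) ∈ B := by
      simp only [hB, mem_ofPred_eq]
      exact fun h => hn h.2
    have h1 := Metric.infDist_le_dist_of_mem (x := (r, (0 : ℝ))) this
    simp only [Prod.dist_eq, Real.dist_eq, sub_self, abs_zero, zero_sub, abs_neg,
      abs_of_nonneg hm] at h1
    rw [max_eq_right hm] at h1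
    exact absurd hlt (not_lt.2 h1)
  set H : ℝ → ℝ := fun r => h r * r + min r 0 + max (r - 1) 0 with hH
  have hHc : Continuous H := by fun_prop
  have hHs : StrictMono H := by
    intro a b hab
    have h3 : max (a - 1) 0 ≤ max (b - 1) 0 := max_le_max (by linarith) le_rfl
    have h2 : min a 0 ≤ min b 0 := min_le_min hab.le le_rfl
    simp only [hH]
    rcases le_or_gt b 0 with hb | hb
    · rw [hneg a (by linarith), hneg b hb, min_eq_left hb, min_eq_left (by linarith : a ≤ 0)]
      linarith
    · have h1 : h a * a < h b * b := by
        rcases le_or_gt a 0 with ha | ha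
        · rw [hneg a ha, zero_mul]; exact mul_pos (hpos b hb) hb
        · nlinarith [hmonoh hab.le, hpos b hb, hpos a ha]
      linarith
  have htop : Tendsto H atTop atTop := by
    refine tendsto_atTop_mono' atTop ?_ (tendsto_atTop_add_const_right atTop (-1) tendsto_id)
    filter_upwards [eventually_ge_atTop 0] with r hr
    simp only [hH, id, min_eq_right hr]
    nlinarith [mul_nonneg (hnonneg r) hr, le_max_left (r - 1) 0]
  have hbot : Tendsto H atBot atBot := by
    refine tendsto_atBot_mono' atBot ?_ tendsto_id
    filter_upwards [eventually_le_atBot 0] with r hr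
    simp only [hH, id, min_eq_left hr, hneg r hr, max_eq_right (by linarith : r - 1 ≤ 0)]
    linarith
  let e := hHs.orderIsoOfSurjective H (hHc.surjective htop hbot)
  have he : ∀ r, e r = H r := fun r => rfl
  have he0 : e 0 = 0 := by simp [he, hH]
  refine ⟨H 1, by simpa [hH] using hpos 1 one_pos, e.symm, e.symm.continuous,
    e.symm.strictMono, by rw [OrderIso.symm_apply_eq, he0], ?_⟩
  rintro η ⟨h0, h1⟩
  have hk0 : 0 < e.symm η := by
    rw [e.lt_symm_apply, he0]; exact h0
  have hk1 : e.symm η < 1 := by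
    rw [e.symm_apply_lt]; exact h1
  refine ⟨hk1, hQ _ _ hk0 h0.le ?_⟩
  have h2 : η = H (e.symm η) := by rw [← he, e.apply_symm_apply]
  simp only [hH] at h2
  rw [min_eq_right hk0.le, max_eq_right (by linarith)] at h2
  nlinarith [hpos _ hk0]

theorem isCompact_simplexE (n : ℕ) : IsCompact (simplexE n) := by
  have h : simplexE n = (EuclideanSpace.equiv (Fin n) ℝ).toHomeomorph ⁻¹' stdSimplex ℝ (Fin n) := by
    ext x; rfl
  rw [h]
  exact (Homeomorph.isCompact_preimage _).2 (isCompact_stdSimplex ℝ (Fin n))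

theorem le_one_of_mem_simplexE {n : ℕ} {θ : EuclideanSpace ℝ (Fin n)} (h : θ ∈ simplexE n)
    (i : Fin n) : θ i ≤ 1 :=
  h.2 ▸ Finset.single_le_sum (f := fun i => θ i) (fun j _ => h.1 j) (Finset.mem_univ i)

theorem VIE_pair {n : ℕ} {i j : Fin n} (hij : i ≠ j) (hJ : ({i, j} : Finset (Fin n)).Nonempty)
    {x : EuclideanSpace ℝ (Fin n)} (hle : x i ≤ x j) (hpos : 0 < x i + x j) :
    VIE {i, j} hJ x = (x j - x i) / (x i + x j) := by
  have h : x i / (x i + x j) ≤ x j / (x i + x j) := by gcongr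
  simp only [VIE, Finset.sum_pair hij]
  simp only [Finset.sup'_insert (Finset.singleton_nonempty j),
    Finset.inf'_insert (Finset.singleton_nonempty j), Finset.sup'_singleton,
    Finset.inf'_singleton]
  rw [sup_eq_right.2 h, inf_eq_left.2 h, sub_div]

/-- An expanding order preserving map increases the ratio of any two distinct positive
coordinates. -/
theorem mul_lt_mul_of_expanding {n : ℕ}
    {τ : EuclideanSpace ℝ (Fin n) → EuclideanSpace ℝ (Fin n)}
    (hτmap : ∀ θ ∈ simplexE n, τ θ ∈ simplexE n)
    (hτord : ∀ θ ∈ simplexE n, ∀ i j : Fin n,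
      (θ i < θ j → τ θ i < τ θ j) ∧ (θ i = θ j → τ θ i = τ θ j))
    (hτexp : ∀ θ ∈ simplexE n, ∀ (J : Finset (Fin n)) (hJ : J.Nonempty),
      0 < J.inf' hJ (fun i => θ i) → J.inf' hJ (fun i => θ i) < J.sup' hJ (fun i => θ i) →
        VIE J hJ θ < VIE J hJ (τ θ))
    {θ : EuclideanSpace ℝ (Fin n)} (hθ : θ ∈ simplexE n) {i j : Fin n}
    (hi : 0 < θ i) (hij : θ i < θ j) : τ θ i * θ j < τ θ j * θ i := by
  have hne : i ≠ j := by rintro rfl; exact lt_irrefl _ hij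
  have hJ : ({i, j} : Finset (Fin n)).Nonempty := ⟨i, by simp⟩
  have hord := (hτord θ hθ i j).1 hij
  have h0 := (hτmap θ hθ).1 i
  have hlt := hτexp θ hθ {i, j} hJ
  simp only [Finset.sup'_insert (Finset.singleton_nonempty j),
    Finset.inf'_insert (Finset.singleton_nonempty j), Finset.sup'_singleton,
    Finset.inf'_singleton, inf_eq_left.2 hij.le, sup_eq_right.2 hij.le] at hlt
  have h1 := hlt hi hij
  rw [VIE_pair hne hJ hij.le (by linarith), VIE_pair hne hJ hord.le (by linarith),
    div_lt_div_iff₀ (by linarith) (by linarith)] at h1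
  nlinarith

/-- A coordinate that vanishes is kept at zero. -/
theorem apply_eq_zero_of_expanding {n : ℕ}
    {τ : EuclideanSpace ℝ (Fin n) → EuclideanSpace ℝ (Fin n)}
    (hτmap : ∀ θ ∈ simplexE n, τ θ ∈ simplexE n)
    (hτcont : ContinuousOn τ (simplexE n))
    (hkey : ∀ θ ∈ simplexE n, ∀ i j : Fin n, 0 < θ i → θ i < θ j →
      τ θ i * θ j < τ θ j * θ i)
    {θ : EuclideanSpace ℝ (Fin n)} (hθ : θ ∈ simplexE n) {i : Fin n} (hi : θ i = 0) :
    τ θ i = 0 := by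
  obtain ⟨j, hj⟩ : ∃ j, 0 < θ j := by
    by_contra! h
    have := Finset.sum_nonpos (s := Finset.univ) (f := fun i => θ i) (fun j _ => h j)
    rw [hθ.2] at this
    linarith
  have hn : (0 : ℝ) < n := by exact_mod_cast i.pos
  let u : EuclideanSpace ℝ (Fin n) := WithLp.toLp 2 fun _ => (n : ℝ)⁻¹
  let p : ℝ → EuclideanSpace ℝ (Fin n) := fun s => (1 - s) • θ + s • u
  have hp : ∀ s k, p s k = (1 - s) * θ k + s * (n : ℝ)⁻¹ := fun s k => by simp [p, u]
  have hps : ∀ s ∈ Ioo (0 : ℝ) 1, p s ∈ simplexE n := by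
    rintro s ⟨h0, h1⟩
    refine ⟨fun k => ?_, ?_⟩
    · rw [hp]
      have := hθ.1 k
      have : 0 ≤ 1 - s := by linarith
      positivity
    · simp only [hp, Finset.sum_add_distrib, ← Finset.mul_sum, hθ.2]
      simp [hn.ne']
  have hp0 : p 0 = θ := by simp [p]
  have hpc : Continuous p := by fun_prop
  have hlim : Tendsto p (𝓝[>] 0) (𝓝[simplexE n] θ) := by
    refine tendsto_nhdsWithin_iff.2 ⟨?_, ?_⟩
    · have := hpc.tendsto 0
      rw [hp0] at this
      exact this.mono_left nhdsWithin_le_nhds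
    · filter_upwards [Ioo_mem_nhdsGT (one_pos : (0 : ℝ) < 1)] with s hs using hps s hs
  have hτ : Tendsto (fun s => τ (p s)) (𝓝[>] 0) (𝓝 (τ θ)) := (hτcont θ hθ).tendsto.comp hlim
  have hcoord : ∀ k, Tendsto (fun x : EuclideanSpace ℝ (Fin n) => x k) (𝓝 (τ θ)) (𝓝 (τ θ k)) :=
    fun k => (by fun_prop : Continuous fun x : EuclideanSpace ℝ (Fin n) => x k).tendsto _
  have hcoord' : ∀ k, Tendsto (fun s => p s k) (𝓝[>] 0) (𝓝 (θ k)) := fun k =>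
    ((by fun_prop : Continuous fun x : EuclideanSpace ℝ (Fin n) => x k).tendsto _).comp
      (hlim.mono_right nhdsWithin_le_nhds)
  have hle : τ θ i * θ j ≤ τ θ j * θ i := by
    refine le_of_tendsto_of_tendsto (((hcoord i).comp hτ).mul (hcoord' j))
      (((hcoord j).comp hτ).mul (hcoord' i)) ?_
    filter_upwards [Ioo_mem_nhdsGT (one_pos : (0 : ℝ) < 1)] with s hs
    refine (hkey (p s) (hps s hs) i j ?_ ?_).le
    · have := hs.1
      rw [hp, hi, mul_zero, zero_add]
      positivity
    · rw [hp, hp, hi]; nlinarith [hs.1, hs.2]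
  rw [hi, mul_zero] at hle
  have h0 := (hτmap θ hθ).1 i
  nlinarith

/-- A group of coordinates lying strictly below all others loses mass. -/
theorem sum_lt_sum_of_expanding {n : ℕ}
    {τ : EuclideanSpace ℝ (Fin n) → EuclideanSpace ℝ (Fin n)}
    (hτmap : ∀ θ ∈ simplexE n, τ θ ∈ simplexE n)
    (hτcont : ContinuousOn τ (simplexE n))
    (hkey : ∀ θ ∈ simplexE n, ∀ i j : Fin n, 0 < θ i → θ i < θ j →
      τ θ i * θ j < τ θ j * θ i)
    {θ : EuclideanSpace ℝ (Fin n)} (hθ : θ ∈ simplexE n) {J : Finset (Fin n)}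
    (hpos : 0 < ∑ i ∈ J, θ i) (hgap : ∀ i ∈ J, ∀ l ∉ J, θ i < θ l) (hJ : J ≠ Finset.univ) :
    ∑ i ∈ J, τ θ i < ∑ i ∈ J, θ i := by
  obtain ⟨l₀, hl₀⟩ : ∃ l, l ∈ Jᶜ := by
    by_contra! h
    exact hJ (Finset.eq_univ_iff_forall.2 fun l => by simpa using h l)
  obtain ⟨i₀, hi₀, hi₀pos⟩ : ∃ i ∈ J, 0 < θ i := by
    by_contra! h
    exact absurd hpos (not_lt.2 (Finset.sum_nonpos h))
  have hlow : ∀ i ∈ J, ∀ l ∈ Jᶜ, τ θ i * θ l ≤ τ θ l * θ i := by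
    intro i hi l hl
    rcases (hθ.1 i).eq_or_lt with h0 | h0
    · rw [apply_eq_zero_of_expanding hτmap hτcont hkey hθ h0.symm, ← h0]; simp
    · exact (hkey θ hθ i l h0 (hgap i hi l (by simpa using hl))).le
  have hprod : (∑ i ∈ J, τ θ i) * (∑ l ∈ Jᶜ, θ l) < (∑ l ∈ Jᶜ, τ θ l) * ∑ i ∈ J, θ i := by
    rw [Finset.sum_mul_sum, mul_comm, Finset.sum_mul_sum]
    refine Finset.sum_lt_sum (fun i hi => Finset.sum_le_sum fun l hl => ?_)
      ⟨i₀, hi₀, Finset.sum_lt_sum (fun l hl => ?_) ⟨l₀, hl₀, ?_⟩⟩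
    · rw [mul_comm (θ i)]; exact hlow i hi l hl
    · rw [mul_comm (θ i₀)]; exact hlow i₀ hi₀ l hl
    · rw [mul_comm (θ i₀)]
      exact hkey θ hθ i₀ l₀ hi₀pos (hgap i₀ hi₀ l₀ (by simpa using hl₀))
  have h1 := Finset.sum_add_sum_compl J fun i => θ i
  have h2 := Finset.sum_add_sum_compl J fun i => τ θ i
  rw [hθ.2] at h1
  rw [(hτmap θ hθ).2] at h2
  rw [eq_sub_of_add_eq' h1, eq_sub_of_add_eq' h2] at hprod
  nlinarith

/-- The drift of `τ θ - θ` is bounded below by `m` at scale `r`, both for the mass of a group of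
coordinates separated from the others and for the ratio of two coordinates. -/
def DriftBound {n : ℕ} (τ : EuclideanSpace ℝ (Fin n) → EuclideanSpace ℝ (Fin n))
    (r m : ℝ) : Prop :=
  (∀ J : Finset (Fin n), J ≠ Finset.univ → ∀ θ ∈ simplexE n, r ≤ ∑ i ∈ J, θ i →
    (∀ i ∈ J, ∀ l ∉ J, θ i + r ≤ θ l) → m ≤ ∑ i ∈ J, θ i - ∑ i ∈ J, τ θ i) ∧
  ∀ i j : Fin n, ∀ θ ∈ simplexE n, r ≤ θ i → (1 + r) * θ i ≤ θ j →
    m ≤ θ i * τ θ j - θ j * τ θ i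

theorem DriftBound.mono {n : ℕ} {τ : EuclideanSpace ℝ (Fin n) → EuclideanSpace ℝ (Fin n)}
    {r r' m m' : ℝ} (h : DriftBound τ r m) (hr : r ≤ r') (hm : m' ≤ m) : DriftBound τ r' m' := by
  refine ⟨fun J hJ θ hθ h1 h2 => hm.trans (h.1 J hJ θ hθ (hr.trans h1) fun i hi l hl => ?_),
    fun i j θ hθ h1 h2 => hm.trans (h.2 i j θ hθ (hr.trans h1) ?_)⟩
  · linarith [h2 i hi l hl]
  · nlinarith [hθ.1 i]

theorem exists_pos_le_of_isClosed {n : ℕ} {f : EuclideanSpace ℝ (Fin n) → ℝ}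
    (hf : ContinuousOn f (simplexE n)) {C : Set (EuclideanSpace ℝ (Fin n))} (hC : IsClosed C)
    (hpos : ∀ θ ∈ simplexE n, θ ∈ C → 0 < f θ) :
    ∀ᶠ m in 𝓝[>] (0 : ℝ), ∀ θ ∈ simplexE n, θ ∈ C → m ≤ f θ := by
  obtain ⟨m, hm, h⟩ := ((isCompact_simplexE n).inter_right hC).exists_forall_le'
    (hf.mono inter_subset_left) (a := 0) fun θ hθ => hpos θ hθ.1 hθ.2
  filter_upwards [Ioo_mem_nhdsGT hm] with m' hm' θ hθ hθC
  exact hm'.2.le.trans (h θ ⟨hθ, hθC⟩)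

theorem exists_driftBound {n : ℕ}
    {τ : EuclideanSpace ℝ (Fin n) → EuclideanSpace ℝ (Fin n)}
    (hτmap : ∀ θ ∈ simplexE n, τ θ ∈ simplexE n)
    (hτcont : ContinuousOn τ (simplexE n))
    (hkey : ∀ θ ∈ simplexE n, ∀ i j : Fin n, 0 < θ i → θ i < θ j →
      τ θ i * θ j < τ θ j * θ i)
    {r : ℝ} (hr : 0 < r) : ∃ m > 0, DriftBound τ r m := by
  have hτi : ∀ i, ContinuousOn (fun θ => τ θ i) (simplexE n) := fun i =>
    (by fun_prop : Continuous fun x : EuclideanSpace ℝ (Fin n) => x i).comp_continuousOn hτcont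
  have h1 : ∀ J : Finset (Fin n), ∀ᶠ m in 𝓝[>] (0 : ℝ), J ≠ Finset.univ → ∀ θ ∈ simplexE n,
      r ≤ ∑ i ∈ J, θ i → (∀ i ∈ J, ∀ l ∉ J, θ i + r ≤ θ l) →
        m ≤ ∑ i ∈ J, θ i - ∑ i ∈ J, τ θ i := by
    intro J
    by_cases hJ : J = Finset.univ
    · simp [hJ]
    have hC : IsClosed {θ : EuclideanSpace ℝ (Fin n) |
        r ≤ ∑ i ∈ J, θ i ∧ ∀ i ∈ J, ∀ l ∉ J, θ i + r ≤ θ l} := by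
      simp only [ofPred_and, ofPred_forall]
      refine (isClosed_le (by fun_prop) (by fun_prop)).inter ?_
      refine isClosed_iInter fun i => isClosed_iInter fun _ => isClosed_iInter fun l =>
        isClosed_iInter fun _ => isClosed_le (by fun_prop) (by fun_prop)
    have hf : ContinuousOn (fun θ : EuclideanSpace ℝ (Fin n) =>
        ∑ i ∈ J, θ i - ∑ i ∈ J, τ θ i) (simplexE n) :=
      ContinuousOn.sub (by fun_prop) (continuousOn_finsetSum _ fun i _ => hτi i)
    filter_upwards [exists_pos_le_of_isClosed hf hC fun θ hθ h => sub_pos.2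
      (sum_lt_sum_of_expanding hτmap hτcont hkey hθ (hr.trans_le h.1)
        (fun i hi l hl => by linarith [h.2 i hi l hl]) hJ)] with m hm _ θ hθ ha hb
    exact hm θ hθ ⟨ha, hb⟩
  have h2 : ∀ i j : Fin n, ∀ᶠ m in 𝓝[>] (0 : ℝ), ∀ θ ∈ simplexE n, r ≤ θ i →
      (1 + r) * θ i ≤ θ j → m ≤ θ i * τ θ j - θ j * τ θ i := by
    intro i j
    have hC : IsClosed {θ : EuclideanSpace ℝ (Fin n) | r ≤ θ i ∧ (1 + r) * θ i ≤ θ j} := by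
      simp only [ofPred_and]
      exact (isClosed_le (by fun_prop) (by fun_prop)).inter
        (isClosed_le (by fun_prop) (by fun_prop))
    have hf : ContinuousOn (fun θ : EuclideanSpace ℝ (Fin n) =>
        θ i * τ θ j - θ j * τ θ i) (simplexE n) :=
      ((by fun_prop : Continuous fun θ : EuclideanSpace ℝ (Fin n) => θ i).continuousOn.mul
        (hτi j)).sub
      ((by fun_prop : Continuous fun θ : EuclideanSpace ℝ (Fin n) => θ j).continuousOn.mul
        (hτi i))
    filter_upwards [exists_pos_le_of_isClosed hf hC fun θ hθ h => by
      have := hkey θ hθ i j (hr.trans_le h.1) (by nlinarith [h.1, h.2])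
      linarith] with m hm θ hθ ha hb
    exact hm θ hθ ⟨ha, hb⟩
  obtain ⟨m, ⟨hm1, hm2⟩, hm⟩ := ((eventually_all.2 h1).and
    (eventually_all.2 fun i => eventually_all.2 (h2 i))).and self_mem_nhdsWithin |>.exists
  exact ⟨m, hm, hm1, hm2⟩

/-- `θ` is a Carathéodory solution on `[t₀, ∞)`, with values in the simplex, of
`θ' = τ θ - θ + ε` with `‖ε‖ ≤ η`. -/
structure IsPerturbedSolution {n : ℕ}
    (τ : EuclideanSpace ℝ (Fin n) → EuclideanSpace ℝ (Fin n)) (η t₀ : ℝ)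
    (ε θ : ℝ → EuclideanSpace ℝ (Fin n)) : Prop where
  measurable : Measurable ε
  norm_le : ∀ t, t₀ ≤ t → ‖ε t‖ ≤ η
  continuousOn : ContinuousOn θ (Ici t₀)
  mem : ∀ t, t₀ ≤ t → θ t ∈ simplexE n
  eq_integral : ∀ t, t₀ ≤ t → θ t = θ t₀ + ∫ s in t₀..t, (τ (θ s) - θ s + ε s)

namespace IsPerturbedSolution

variable {n : ℕ} {τ : EuclideanSpace ℝ (Fin n) → EuclideanSpace ℝ (Fin n)} {η t₀ : ℝ}
  {ε θ : ℝ → EuclideanSpace ℝ (Fin n)}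

theorem continuousOn_drift (hs : IsPerturbedSolution τ η t₀ ε θ)
    (hτcont : ContinuousOn τ (simplexE n)) :
    ContinuousOn (fun s => τ (θ s) - θ s) (Ici t₀) :=
  (hτcont.comp hs.continuousOn hs.mem).sub hs.continuousOn

theorem intervalIntegrable (hs : IsPerturbedSolution τ η t₀ ε θ)
    (hτcont : ContinuousOn τ (simplexE n)) {a b : ℝ} (ha : t₀ ≤ a) (hab : a ≤ b) :
    IntervalIntegrable (fun s => τ (θ s) - θ s + ε s) MeasureTheory.volume a b := by
  refine IntervalIntegrable.add (ContinuousOn.intervalIntegrable ?_) ?_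
  · rw [uIcc_of_le hab]
    exact (hs.continuousOn_drift hτcont).mono fun s hs => ha.trans hs.1
  · refine (intervalIntegrable_const (c := η)).mono_fun hs.measurable.aestronglyMeasurable ?_
    refine (MeasureTheory.ae_restrict_iff' measurableSet_uIoc).2 (MeasureTheory.ae_of_all _ fun s h => ?_)
    rw [uIoc_of_le hab] at h
    exact (hs.norm_le s (ha.trans h.1.le)).trans (le_abs_self η)

theorem eventually_mul_sub_le (hs : IsPerturbedSolution τ η t₀ ε θ)
    (hτcont : ContinuousOn τ (simplexE n)) (l : EuclideanSpace ℝ (Fin n) →L[ℝ] ℝ) {t c e : ℝ}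
    (ht : t₀ ≤ t) (hε : ∀ s, t₀ ≤ s → -e ≤ l (ε s)) (hF : c + e < l (τ (θ t) - θ t)) :
    ∀ᶠ z in 𝓝[>] t, c * (z - t) ≤ l (θ z) - l (θ t) := by
  have hc : ContinuousOn (fun s => l (τ (θ s) - θ s)) (Ici t₀) :=
    l.continuous.comp_continuousOn (hs.continuousOn_drift hτcont)
  have hev : ∀ᶠ s in 𝓝[≥] t, c + e < l (τ (θ s) - θ s) :=
    ((hc t ht).mono (Ici_subset_Ici.2 ht)).eventually (lt_mem_nhds hF)
  obtain ⟨u, hu, hsub⟩ := mem_nhdsGE_iff_exists_Ico_subset.1 hev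
  filter_upwards [Ioo_mem_nhdsGT hu] with z hz
  have hint := hs.intervalIntegrable hτcont ht hz.1.le
  have hdiff : θ z - θ t = ∫ s in t..z, (τ (θ s) - θ s + ε s) := by
    rw [hs.eq_integral z (ht.trans hz.1.le), hs.eq_integral t ht,
      ← intervalIntegral.integral_add_adjacent_intervals
        (hs.intervalIntegrable hτcont le_rfl ht) hint]
    abel
  rw [← map_sub, hdiff, ← l.intervalIntegral_comp_comm hint]
  have hconst : c * (z - t) = ∫ _ in t..z, c := by simp [mul_comm]
  rw [hconst]
  refine intervalIntegral.integral_mono_on hz.1.le intervalIntegrable_const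
    ⟨l.integrable_comp hint.1, l.integrable_comp hint.2⟩ fun s h => ?_
  have h1 : c + e < l (τ (θ s) - θ s) := hsub ⟨h.1, h.2.trans_lt hz.2⟩
  rw [map_add]
  linarith [hε s (ht.trans h.1)]

theorem abs_apply_le (hs : IsPerturbedSolution τ η t₀ ε θ) {s : ℝ} (h : t₀ ≤ s) (i : Fin n) :
    |ε s i| ≤ η :=
  (PiLp.norm_apply_le (ε s) i).trans (hs.norm_le s h)

theorem eventually_sum_le (hs : IsPerturbedSolution τ η t₀ ε θ)
    (hτcont : ContinuousOn τ (simplexE n)) {r : ℝ} (hη : 0 < η)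
    (hdrift : DriftBound τ r ((n + 3) * η)) {J : Finset (Fin n)} (hJ : J ≠ Finset.univ)
    {t : ℝ} (ht : t₀ ≤ t) (hsum : r ≤ ∑ i ∈ J, θ t i)
    (hgap : ∀ i ∈ J, ∀ l ∉ J, θ t i + r ≤ θ t l) :
    ∀ᶠ z in 𝓝[>] t, ∑ i ∈ J, θ z i ≤ ∑ i ∈ J, θ t i := by
  let l : EuclideanSpace ℝ (Fin n) →L[ℝ] ℝ := -∑ i ∈ J, EuclideanSpace.proj (𝕜 := ℝ) i
  have hl : ∀ x, l x = -∑ i ∈ J, x i := fun x => by simp [l]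
  have hε : ∀ s, t₀ ≤ s → -(n * η) ≤ l (ε s) := by
    intro s h
    rw [hl, neg_le_neg_iff]
    calc ∑ i ∈ J, ε s i ≤ ∑ i ∈ J, η :=
          Finset.sum_le_sum fun i _ => (le_abs_self _).trans (hs.abs_apply_le h i)
      _ = J.card * η := by simp
      _ ≤ n * η := by
          gcongr
          exact_mod_cast (Finset.card_le_univ J).trans_eq (Fintype.card_fin n)
  have hF : 0 + n * η < l (τ (θ t) - θ t) := by
    have := hdrift.1 J hJ (θ t) (hs.mem t ht) hsum hgap
    rw [hl]
    simp only [PiLp.sub_apply, Finset.sum_sub_distrib]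
    linarith
  filter_upwards [hs.eventually_mul_sub_le hτcont l ht hε hF] with z hz
  rw [hl, hl] at hz
  linarith

theorem eventually_ratio_le (hs : IsPerturbedSolution τ η t₀ ε θ)
    (hτcont : ContinuousOn τ (simplexE n)) {r : ℝ} (hr : 0 < r) (hη : 0 < η)
    (hdrift : DriftBound τ r ((n + 3) * η)) {i j : Fin n}
    (hi : ∀ t, t₀ ≤ t → r ≤ θ t i) {t : ℝ} (ht : t₀ ≤ t) (hij : 1 + r ≤ θ t j / θ t i) :
    ∀ᶠ z in 𝓝[>] t, θ t j / θ t i + η * (z - t) ≤ θ z j / θ z i := by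
  have hi0 := hr.trans_le (hi t ht)
  let l : EuclideanSpace ℝ (Fin n) →L[ℝ] ℝ :=
    θ t i • EuclideanSpace.proj (𝕜 := ℝ) j - θ t j • EuclideanSpace.proj (𝕜 := ℝ) i
  have hl : ∀ x, l x = θ t i * x j - θ t j * x i := fun x => by simp [l]
  have hε : ∀ s, t₀ ≤ s → -(2 * η) ≤ l (ε s) := by
    intro s h
    rw [hl]
    have h1 := abs_le.1 (hs.abs_apply_le h i)
    have h2 := abs_le.1 (hs.abs_apply_le h j)
    have h3 := le_one_of_mem_simplexE (hs.mem t ht) i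
    have h4 := le_one_of_mem_simplexE (hs.mem t ht) j
    have h5 := (hs.mem t ht).1 j
    nlinarith
  have hn : (0 : ℝ) < n := by exact_mod_cast i.pos
  have hF : η + 2 * η < l (τ (θ t) - θ t) := by
    have := hdrift.2 i j (θ t) (hs.mem t ht) (hi t ht) ((le_div_iff₀ hi0).1 hij)
    rw [hl]
    simp only [PiLp.sub_apply]
    nlinarith
  filter_upwards [hs.eventually_mul_sub_le hτcont l ht hε hF, self_mem_nhdsWithin] with z hz htz
  have htz : t < z := htz
  have hz0 := hr.trans_le (hi z (ht.trans htz.le))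
  have hz1 := le_one_of_mem_simplexE (hs.mem z (ht.trans htz.le)) i
  have ht1 := le_one_of_mem_simplexE (hs.mem t ht) i
  rw [hl, hl] at hz
  have hdiff : θ z j / θ z i - θ t j / θ t i
      = (θ t i * θ z j - θ t j * θ z i) / (θ t i * θ z i) := by
    field_simp
  have hprod : θ t i * θ z i ≤ 1 := mul_le_one₀ ht1 hz0.le hz1
  have hnum : 0 ≤ η * (z - t) := mul_nonneg hη.le (by linarith)
  have : η * (z - t) ≤ θ z j / θ z i - θ t j / θ t i := by
    rw [hdiff, le_div_iff₀ (mul_pos hi0 hz0)]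
    nlinarith
  linarith

/-- A coordinate that is at most `r` never exceeds `4 ^ n * r` afterwards. -/
theorem apply_le_of_apply_le (hs : IsPerturbedSolution τ η t₀ ε θ)
    (hτcont : ContinuousOn τ (simplexE n)) {r : ℝ} (hr : 0 < r) (hr1 : 4 ^ n * r < 1)
    (hη : 0 < η) (hdrift : DriftBound τ r ((n + 3) * η)) {k : Fin n} {a b : ℝ} (ha : t₀ ≤ a)
    (hab : a ≤ b) (hk : θ a k ≤ r) : θ b k ≤ 4 ^ n * r := by
  set S : Set ℝ := {t | ∃ J : Finset (Fin n), k ∈ J ∧ ∑ i ∈ J, θ t i ≤ 4 ^ J.card * r} with hS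
  have hcont : ∀ J : Finset (Fin n), ContinuousOn (fun t => ∑ i ∈ J, θ t i) (Ici t₀) := fun J =>
    (by fun_prop : Continuous fun x : EuclideanSpace ℝ (Fin n) => ∑ i ∈ J, x i).comp_continuousOn
      hs.continuousOn
  have hclosed : IsClosed (S ∩ Icc a b) := by
    have hSeq : S ∩ Icc a b = ⋃ J ∈ {J : Finset (Fin n) | k ∈ J},
        (Icc a b ∩ (fun t => ∑ i ∈ J, θ t i) ⁻¹' Iic (4 ^ J.card * r)) := by
      ext t
      simp only [hS, mem_inter_iff, mem_ofPred_eq, mem_iUnion, mem_preimage, mem_Iic,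
        exists_prop]
      tauto
    rw [hSeq]
    exact (toFinite _).isClosed_biUnion fun J _ =>
      ((hcont J).mono fun s h => ha.trans h.1).preimage_isClosed_of_isClosed isClosed_Icc
        isClosed_Iic
  have hstep : ∀ t ∈ S ∩ Ico a b, S ∈ 𝓝[>] t := by
    rintro t ⟨⟨J₀, hkJ₀, hJ₀⟩, hta, htb⟩
    have ht : t₀ ≤ t := ha.trans hta
    have hmem := hs.mem t ht
    by_cases hlt : ∃ J : Finset (Fin n), k ∈ J ∧ ∑ i ∈ J, θ t i < 4 ^ J.card * r
    · obtain ⟨J, hkJ, hJ⟩ := hlt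
      have hc : ContinuousWithinAt (fun t => ∑ i ∈ J, θ t i) (Ioi t) t :=
        ((hcont J) t ht).mono (Ioi_subset_Ici_self.trans (Ici_subset_Ici.2 ht))
      filter_upwards [hc.eventually (gt_mem_nhds hJ)] with z hz
      exact ⟨J, hkJ, hz.le⟩
    push Not at hlt
    have hcn : ∀ m ≤ n, (4 : ℝ) ^ m * r ≤ 4 ^ n * r := fun m hm => by
      gcongr
      norm_num
    have hJne : J₀ ≠ Finset.univ := by
      rintro rfl
      rw [hmem.2, Finset.card_univ, Fintype.card_fin] at hJ₀
      linarith
    have hp : 1 ≤ (4 : ℝ) ^ J₀.card := one_le_pow₀ (by norm_num)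
    have hev := hs.eventually_sum_le hτcont hη hdrift hJne ht
      (by nlinarith [hlt J₀ hkJ₀]) (fun i hi l hl => by
        have h1 := hlt (insert l J₀) (Finset.mem_insert_of_mem hkJ₀)
        rw [Finset.sum_insert hl, Finset.card_insert_of_notMem hl, pow_succ] at h1
        have h2 : θ t i ≤ ∑ i ∈ J₀, θ t i :=
          Finset.single_le_sum (f := fun i => θ t i) (fun j _ => hmem.1 j) hi
        nlinarith)
    filter_upwards [hev] with z hz
    exact ⟨J₀, hkJ₀, hz.trans hJ₀⟩
  have haS : a ∈ S := ⟨{k}, by simp, by simp; linarith⟩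
  obtain ⟨J, hkJ, hJ⟩ := hclosed.Icc_subset_of_forall_mem_nhdsWithin haS hstep
    (right_mem_Icc.2 hab)
  have h1 : θ b k ≤ ∑ i ∈ J, θ b i :=
    Finset.single_le_sum (f := fun i => θ b i) (fun j _ => (hs.mem b (ha.trans hab)).1 j) hkJ
  have h2 : (4 : ℝ) ^ J.card ≤ 4 ^ n :=
    pow_le_pow_right₀ (by norm_num) ((Finset.card_le_univ J).trans_eq (Fintype.card_fin n))
  nlinarith

/-- If the coordinate `i` starts strictly below the coordinate `j`, it does not stay above `r`. -/
theorem exists_apply_le (hs : IsPerturbedSolution τ η t₀ ε θ)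
    (hτcont : ContinuousOn τ (simplexE n)) {r : ℝ} (hr : 0 < r) (hη : 0 < η)
    (hdrift : DriftBound τ r ((n + 3) * η)) {i j : Fin n}
    (hij : (1 + r) * θ t₀ i ≤ θ t₀ j) : ∃ t, t₀ ≤ t ∧ θ t i ≤ r := by
  by_contra! hcon
  have hpos : ∀ t, t₀ ≤ t → 0 < θ t i := fun t ht => hr.trans (hcon t ht)
  have hgrow : ∀ b, t₀ ≤ b → 1 + r + η * (b - t₀) ≤ θ b j / θ b i := by
    intro b hb
    have hcont : ContinuousOn (fun t => θ t j / θ t i) (Ici t₀) := by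
      have h : ∀ k, ContinuousOn (fun t => θ t k) (Ici t₀) := fun k =>
        (by fun_prop : Continuous fun x : EuclideanSpace ℝ (Fin n) => x k).comp_continuousOn
          hs.continuousOn
      exact (h j).div (h i) fun t ht => (hpos t ht).ne'
    set S : Set ℝ := {t | 1 + r + η * (t - t₀) ≤ θ t j / θ t i} with hS
    have hclosed : IsClosed (S ∩ Icc t₀ b) := by
      rw [inter_comm]
      exact isClosed_Icc.isClosed_le (f := fun t => 1 + r + η * (t - t₀)) (by fun_prop)
        (hcont.mono Icc_subset_Ici_self)
    refine hclosed.Icc_subset_of_forall_mem_nhdsWithin ?_ ?_ (right_mem_Icc.2 hb)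
    · simp only [hS, mem_ofPred_eq, sub_self, mul_zero, add_zero]
      exact (le_div_iff₀ (hpos t₀ le_rfl)).2 hij
    · rintro t ⟨htS, hta, -⟩
      simp only [hS, mem_ofPred_eq] at htS
      have h0 : 0 ≤ η * (t - t₀) := mul_nonneg hη.le (by linarith)
      filter_upwards [hs.eventually_ratio_le hτcont hr hη hdrift (fun t ht => (hcon t ht).le) hta
        (by linarith)] with z hz
      simp only [hS, mem_ofPred_eq]
      linarith
  obtain ⟨b, hb, hbr⟩ : ∃ b, t₀ ≤ b ∧ η * (b - t₀) = r⁻¹ :=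
    ⟨t₀ + r⁻¹ / η, le_add_of_nonneg_right (by positivity), by field_simp; ring⟩
  have h1 := hgrow b hb
  have h2 : θ b j / θ b i ≤ 1 / r :=
    div_le_div₀ zero_le_one (le_one_of_mem_simplexE (hs.mem b hb) j) hr (hcon b hb).le
  rw [one_div] at h2
  linarith

theorem eventually_mem_OmegaHighE (hs : IsPerturbedSolution τ η t₀ ε θ)
    (hτcont : ContinuousOn τ (simplexE n)) {κ : ℝ} (hκ : 0 < κ) (hκ1 : κ < 1) (hη : 0 < η)
    (hdrift : DriftBound τ (κ / 4 ^ n) ((n + 3) * η)) {I : Finset (Fin n)} (hI : I.Nonempty)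
    (hV : κ < VIE I hI (θ t₀)) : ∀ᶠ t in atTop, θ t ∈ OmegaHighE I hI κ := by
  have hmem := hs.mem t₀ le_rfl
  obtain ⟨j, hj, hjsup⟩ := I.exists_mem_eq_sup' hI fun i => θ t₀ i / ∑ j ∈ I, θ t₀ j
  obtain ⟨i, hi, hiinf⟩ := I.exists_mem_eq_inf' hI fun i => θ t₀ i / ∑ j ∈ I, θ t₀ j
  rw [VIE, hjsup, hiinf, ← sub_div] at hV
  have hSpos : 0 < ∑ j ∈ I, θ t₀ j := by
    refine (Finset.sum_nonneg fun k _ => hmem.1 k).lt_of_ne fun h => ?_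
    rw [← h, div_zero] at hV
    exact lt_asymm hV hκ
  rw [lt_div_iff₀ hSpos] at hV
  have hiS : θ t₀ i ≤ ∑ j ∈ I, θ t₀ j :=
    Finset.single_le_sum (f := fun i => θ t₀ i) (fun j _ => hmem.1 j) hi
  have hp : 1 ≤ (4 : ℝ) ^ n := one_le_pow₀ (by norm_num)
  have hr : 0 < κ / 4 ^ n := by positivity
  have hrκ : κ / 4 ^ n ≤ κ := div_le_self hκ.le hp
  have hrκ' : 4 ^ n * (κ / 4 ^ n) = κ := by field_simp
  obtain ⟨a, ha, hai⟩ := hs.exists_apply_le hτcont hr hη hdrift (i := i) (j := j) <| calc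
      (1 + κ / 4 ^ n) * θ t₀ i ≤ (1 + κ) * θ t₀ i :=
        mul_le_mul_of_nonneg_right (by gcongr) (hmem.1 i)
      _ ≤ θ t₀ j := by nlinarith
  filter_upwards [eventually_ge_atTop a] with t hat
  refine ⟨hs.mem t (ha.trans hat), (Finset.inf'_le _ hi).trans ?_⟩
  have := hs.apply_le_of_apply_le hτcont hr (by rwa [hrκ']) hη hdrift ha hat hai
  rwa [hrκ'] at this

end IsPerturbedSolution

/-- Points with a coordinate in `I` of size at most `a` are close to the face where a coordinate
in `I` vanishes. -/
theorem infDist_OmegaHighE_zero_le {n : ℕ} [Nontrivial (Fin n)] {I : Finset (Fin n)}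
    (hI : I.Nonempty) {a : ℝ} {θ : EuclideanSpace ℝ (Fin n)} (h : θ ∈ OmegaHighE I hI a) :
    Metric.infDist θ (OmegaHighE I hI 0) ≤ 2 * a := by
  obtain ⟨hmem, hle⟩ := h
  obtain ⟨i, hi, hinf⟩ := I.exists_mem_eq_inf' hI fun i => θ i
  rw [hinf] at hle
  obtain ⟨l, hl⟩ := exists_ne i
  let v : EuclideanSpace ℝ (Fin n) := EuclideanSpace.single l (θ i) - EuclideanSpace.single i (θ i)
  have hv : ∀ k, (θ + v) k = θ k + ((if k = l then θ i else 0) - if k = i then θ i else 0) :=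
    fun k => by simp [v]
  have hy : θ + v ∈ OmegaHighE I hI 0 := by
    refine ⟨⟨fun k => ?_, ?_⟩, (Finset.inf'_le _ hi).trans ?_⟩
    · have h1 := hmem.1 k
      have h2 := hmem.1 i
      rw [hv]
      split_ifs with h3 h4 h4
      · linarith
      · linarith
      · subst h4; linarith
      · linarith
    · simp only [hv, Finset.sum_add_distrib, Finset.sum_sub_distrib, hmem.2]
      simp
    · rw [hv, if_neg hl.symm, if_pos rfl]; linarith
  refine (Metric.infDist_le_dist_of_mem hy).trans ?_
  rw [dist_self_add_right]
  refine (norm_sub_le _ _).trans ?_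
  rw [PiLp.norm_single, PiLp.norm_single, Real.norm_of_nonneg (hmem.1 i)]
  linarith

theorem nontrivial_of_VIE_pos {n : ℕ} {I : Finset (Fin n)} (hI : I.Nonempty)
    {θ : EuclideanSpace ℝ (Fin n)} (h : 0 < VIE I hI θ) : Nontrivial (Fin n) := by
  obtain ⟨j, -, hj⟩ := I.exists_mem_eq_sup' hI fun i => θ i / ∑ j ∈ I, θ j
  obtain ⟨i, -, hi⟩ := I.exists_mem_eq_inf' hI fun i => θ i / ∑ j ∈ I, θ j
  refine ⟨i, j, ?_⟩
  rintro rfl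
  rw [VIE, hj, hi, sub_self] at h
  exact lt_irrefl _ h

end ModeCollapse

/-- Low temperature leads to mode collapse (ODE version): if `τ : Δⁿ → Δⁿ` is continuous,
order preserving and expanding, then for every nonempty index set `I` there exist `η̄ > 0`
and a class-K function `κ` on `[0, η̄)` such that every (Carathéodory, i.e. integral-form)
solution of `θ' = τ(θ) − θ + ε` with `‖ε‖ ≤ η < η̄` that starts outside `Ω̲_I(κ(η))`
converges to `Ω̄_I(κ(η))`. -/
theorem low_temperature_ode_convergence {n : ℕ}
    (τ : EuclideanSpace ℝ (Fin n) → EuclideanSpace ℝ (Fin n))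
    (hτmap : ∀ θ ∈ simplexE n, τ θ ∈ simplexE n)
    (hτcont : ContinuousOn τ (simplexE n))
    (hτord : ∀ θ ∈ simplexE n, ∀ i j : Fin n,
      (θ i < θ j → τ θ i < τ θ j) ∧ (θ i = θ j → τ θ i = τ θ j))
    (hτexp : ∀ θ ∈ simplexE n, ∀ (J : Finset (Fin n)) (hJ : J.Nonempty),
      0 < J.inf' hJ (fun i => θ i) → J.inf' hJ (fun i => θ i) < J.sup' hJ (fun i => θ i) →
        VIE J hJ θ < VIE J hJ (τ θ))
    (I : Finset (Fin n)) (hI : I.Nonempty) :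
    ∃ ηbar > (0 : ℝ), ∃ κ : ℝ → ℝ,
      (ContinuousOn κ (Set.Ico 0 ηbar) ∧ StrictMonoOn κ (Set.Ico 0 ηbar) ∧ κ 0 = 0 ∧
        ∀ x ∈ Set.Ico (0 : ℝ) ηbar, 0 ≤ κ x) ∧
      ∀ η ∈ Set.Ico (0 : ℝ) ηbar, ∀ t₀ : ℝ,
        ∀ ε : ℝ → EuclideanSpace ℝ (Fin n), Measurable ε → (∀ t, t₀ ≤ t → ‖ε t‖ ≤ η) →
        ∀ θ : ℝ → EuclideanSpace ℝ (Fin n),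
          ContinuousOn θ (Set.Ici t₀) →
          (∀ t, t₀ ≤ t → θ t ∈ simplexE n) →
          (∀ t, t₀ ≤ t → θ t = θ t₀ + ∫ s in t₀..t, (τ (θ s) - θ s + ε s)) →
          θ t₀ ∉ OmegaLowE I hI (κ η) →
          Tendsto (fun t => Metric.infDist (θ t) (OmegaHighE I hI (κ η))) atTop (nhds 0) := by
  have hkey : ∀ θ ∈ simplexE n, ∀ i j : Fin n, 0 < θ i → θ i < θ j →
      τ θ i * θ j < τ θ j * θ i := fun θ hθ i j =>
    mul_lt_mul_of_expanding hτmap hτord hτexp hθ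
  have h3 : (0 : ℝ) < n + 3 := by positivity
  obtain ⟨ηbar, hηbar, κ, hκc, hκm, hκ0, hκ⟩ := exists_classK_of_monotone
    (Q := fun r m => DriftBound τ (r / 4 ^ n) ((n + 3) * m))
    (fun r r' m m' _ hr hm h => h.mono (by gcongr) (by gcongr))
    (fun r hr => by
      obtain ⟨m, hm, h⟩ := exists_driftBound hτmap hτcont hkey
        (div_pos hr (by positivity : (0 : ℝ) < 4 ^ n))
      exact ⟨m / (n + 3), div_pos hm h3, h.mono le_rfl (by field_simp; rfl)⟩)
  have hκnonneg : ∀ x, 0 ≤ x → 0 ≤ κ x := fun x hx => hκ0 ▸ hκm.monotone hx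
  refine ⟨ηbar, hηbar, κ, ⟨hκc.continuousOn, hκm.strictMonoOn _, hκ0,
    fun x hx => hκnonneg x hx.1⟩, ?_⟩
  intro η hη t₀ ε hεm hεb θ hθc hθmem hθeq hout
  have hV : κ η < VIE I hI (θ t₀) := by
    by_contra h
    exact hout ⟨hθmem t₀ le_rfl, not_lt.1 h⟩
  have hmain : ∀ η' ∈ Set.Ioo 0 ηbar, η ≤ η' → κ η' < VIE I hI (θ t₀) →
      ∀ᶠ t in atTop, θ t ∈ OmegaHighE I hI (κ η') := by
    intro η' hη' hle hV'
    have hs : IsPerturbedSolution τ η' t₀ ε θ :=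
      ⟨hεm, fun t ht => (hεb t ht).trans hle, hθc, hθmem, hθeq⟩
    exact hs.eventually_mem_OmegaHighE hτcont (hκ0 ▸ hκm hη'.1) (hκ η' hη').1 hη'.1
      (hκ η' hη').2 hI hV'
  rcases hη.1.eq_or_lt with h0 | h0
  · subst h0
    rw [hκ0] at hV ⊢
    have := nontrivial_of_VIE_pos hI hV
    rw [Metric.tendsto_nhds]
    intro δ hδ
    have hlim : Tendsto κ (nhdsWithin 0 (Set.Ioi 0)) (nhds 0) := by
      have := hκc.tendsto 0
      rw [hκ0] at this
      exact this.mono_left nhdsWithin_le_nhds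
    obtain ⟨η', hlt, hη'⟩ := ((hlim.eventually (gt_mem_nhds (lt_min hV (half_pos hδ)))).and
      (Ioo_mem_nhdsGT hηbar)).exists
    rw [lt_min_iff] at hlt
    filter_upwards [hmain η' hη' hη'.1.le hlt.1] with t ht
    rw [Real.dist_0_eq_abs, abs_of_nonneg Metric.infDist_nonneg]
    linarith [infDist_OmegaHighE_zero_le hI ht, hlt.2]
  · refine tendsto_const_nhds.congr' ?_
    filter_upwards [hmain η ⟨h0, hη.2⟩ le_rfl hV] with t ht
    exact (Metric.infDist_zero_of_mem ht).symm
end
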